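/- (Upper bound at jumps.) Assume the norm ‖·‖ is of class C¹ on ℝ^d ∖ {0}. Let (ε_k) be a sequence with ε_k → 0⁺; for each k, suppose x^{ε_k} : [0,T] → ℝ^d is the pointwise limit of a sequence of discretized solutions x^{ε_k,τ_{k,n}} (with τ_{k,n} → 0 as n → ∞ and common initial datum x₀), and suppose x^{ε_k}(t) → u(t) as k → ∞ for every t ∈ [0,T]. Let t ∈ (0,T] be such that the left limit u(t⁻) := lim_{s→t⁻} u(s) exists and u(t⁻) ≠ u(t). Then Δ_new(t;u(t⁻),u(t)) ≤ E(t,u(t⁻)) − E(t,u(t)). -/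

import Mathlib

open Filter MeasureTheory Set
open scoped Topology NNReal

section Setup

variable {X : Type*} [NormedAddCommGroup X] [NormedSpace ℝ X]

/-- The set of partition sums defining the `Ψ`-dissipation of `u` on `[a,b]`:
sums `∑ Ψ(u(s_i) − u(s_{i−1}))` over finite strictly increasing partitions
`a = s₀ < s₁ < ⋯ < s_n = b`. -/
def dissSums (Ψ : X → ℝ) (u : ℝ → X) (a b : ℝ) : Set ℝ :=
  { S | ∃ (n : ℕ) (σ : Fin (n + 1) → ℝ), StrictMono σ ∧ σ 0 = a ∧ σ (Fin.last n) = b ∧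
      S = ∑ i : Fin n, Ψ (u (σ i.succ) - u (σ i.castSucc)) }

/-- The `Ψ`-dissipation `Diss_Ψ(u;[a,b])`. -/
noncomputable def dissTV (Ψ : X → ℝ) (u : ℝ → X) (a b : ℝ) : ℝ :=
  sSup (dissSums Ψ u a b)

/-- The subdifferential `∂Ψ(0) = {η : ⟨η,v⟩ ≤ Ψ(v) for all v}`. -/
def subdiffZero (Ψ : X → ℝ) : Set (X →L[ℝ] ℝ) :=
  { η | ∀ v, η v ≤ Ψ v }

/-- `inf_{η ∈ ∂Ψ(0)} ‖ξ + η‖_*`, where `‖·‖_*` is the dual (operator) norm. -/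
noncomputable def distToSubdiff (Ψ : X → ℝ) (ξ : X →L[ℝ] ℝ) : ℝ :=
  sInf ((fun η => ‖ξ + η‖) '' subdiffZero Ψ)

/-- The cost `Δ_new(t;a,b)`: infimum over Lipschitz paths `γ : [0,1] → X` with
`γ(0)=a`, `γ(1)=b` of `∫₀¹ Ψ(γ'(s)) + (inf_{z∈∂Ψ(0)} ‖D_xE(t,γ(s))+z‖_*)·‖γ'(s)‖ ds`. -/
noncomputable def deltaNew (DE : ℝ → X → X →L[ℝ] ℝ) (Ψ : X → ℝ) (t : ℝ) (a b : X) : ℝ :=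
  sInf { c | ∃ (K : ℝ≥0) (γ : ℝ → X), LipschitzOnWith K γ (Icc 0 1) ∧ γ 0 = a ∧ γ 1 = b ∧
      c = ∫ s in (0:ℝ)..1, (Ψ (deriv γ s) + distToSubdiff Ψ (DE t (γ s)) * ‖deriv γ s‖) }

/-- The new dissipation `Diss_new(u;[t₁,t₂])`, with prescribed one-sided limit
functions `uL`, `uR`, summing over the jump set the corrections `Δ_new − Ψ`. -/
noncomputable def dissNew (DE : ℝ → X → X →L[ℝ] ℝ) (Ψ : X → ℝ)
    (u uL uR : ℝ → X) (t₁ t₂ : ℝ) : ℝ :=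
  dissTV Ψ u t₁ t₂
    + ∑' t : ({ s | ¬ ContinuousAt u s } ∩ Ioo t₁ t₂ : Set ℝ),
        (deltaNew DE Ψ (t : ℝ) (uL (t : ℝ)) (u (t : ℝ)) +
          deltaNew DE Ψ (t : ℝ) (u (t : ℝ)) (uR (t : ℝ))
          - Ψ (u (t : ℝ) - uL (t : ℝ)) - Ψ (uR (t : ℝ) - u (t : ℝ)))
    + (deltaNew DE Ψ t₁ (u t₁) (uR t₁) - Ψ (uR t₁ - u t₁))
    + (deltaNew DE Ψ t₂ (uL t₂) (u t₂) - Ψ (u t₂ - uL t₂))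

/-- `pts` is a discretized solution with initial datum `x₀`, neighborhood size `ε`,
time-step `τ` and `N` steps: `pts 0 = x₀` and each `pts i` minimizes
`x ↦ E(iτ, x) + Ψ(x − pts (i−1))` over the closed ball of radius `ε` around `pts (i−1)`. -/
def IsDiscreteSol (E : ℝ → X → ℝ) (Ψ : X → ℝ) (x₀ : X) (ε τ : ℝ) (N : ℕ)
    (pts : ℕ → X) : Prop :=
  pts 0 = x₀ ∧ ∀ i : ℕ, 1 ≤ i → i ≤ N →
    ‖pts i - pts (i - 1)‖ ≤ ε ∧
    ∀ x : X, ‖x - pts (i - 1)‖ ≤ ε →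
      E ((i : ℝ) * τ) (pts i) + Ψ (pts i - pts (i - 1)) ≤
        E ((i : ℝ) * τ) x + Ψ (x - pts (i - 1))

/-- The piecewise-constant interpolant `x^{ε,τ}`: equal to `pts (i−1)` on
`[(i−1)τ, iτ)` for `i = 1,…,N`, and to `pts N` on `[Nτ, T]`. -/
noncomputable def discInterp (pts : ℕ → X) (τ : ℝ) (N : ℕ) (t : ℝ) : X :=
  pts (min N ⌊t / τ⌋₊)

end Setup

section Dissipation

variable {X : Type*} [NormedAddCommGroup X] [NormedSpace ℝ X] {Ψ : X → ℝ}

theorem sublinear_add_le (hΨconv : ConvexOn ℝ Set.univ Ψ)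
    (hΨhom : ∀ c : ℝ, 0 ≤ c → ∀ v : X, Ψ (c • v) = c * Ψ v) (v w : X) :
    Ψ (v + w) ≤ Ψ v + Ψ w := by
  have h := hΨconv.2 (mem_univ v) (mem_univ w) (one_half_pos (α := ℝ)).le one_half_pos.le
    (add_halves 1)
  rw [← smul_add, hΨhom _ (by norm_num)] at h
  simp only [smul_eq_mul] at h
  linarith

theorem bddBelow_norm_add_image (S : Set (X →L[ℝ] ℝ)) (ξ : X →L[ℝ] ℝ) :
    BddBelow ((fun η => ‖ξ + η‖) '' S) :=
  ⟨0, by rintro _ ⟨η, -, rfl⟩; exact norm_nonneg _⟩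

theorem zero_mem_subdiffZero (hΨnn : ∀ v, 0 ≤ Ψ v) : (0 : X →L[ℝ] ℝ) ∈ subdiffZero Ψ :=
  fun v => by simpa using hΨnn v

theorem distToSubdiff_nonneg (ξ : X →L[ℝ] ℝ) : 0 ≤ distToSubdiff Ψ ξ :=
  Real.sInf_nonneg (by rintro _ ⟨η, -, rfl⟩; exact norm_nonneg _)

theorem distToSubdiff_le_norm (hΨnn : ∀ v, 0 ≤ Ψ v) (ξ : X →L[ℝ] ℝ) :
    distToSubdiff Ψ ξ ≤ ‖ξ‖ :=
  csInf_le (bddBelow_norm_add_image _ _) ⟨0, zero_mem_subdiffZero hΨnn, by simp⟩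

theorem distToSubdiff_le_add (hΨnn : ∀ v, 0 ≤ Ψ v) (ξ ξ' : X →L[ℝ] ℝ) :
    distToSubdiff Ψ ξ ≤ distToSubdiff Ψ ξ' + ‖ξ - ξ'‖ := by
  rw [← sub_le_iff_le_add]
  refine le_csInf ⟨_, 0, zero_mem_subdiffZero hΨnn, rfl⟩ ?_
  rintro _ ⟨η, hη, rfl⟩
  rw [sub_le_iff_le_add]
  calc distToSubdiff Ψ ξ ≤ ‖ξ + η‖ := csInf_le (bddBelow_norm_add_image _ _) ⟨η, hη, rfl⟩
    _ = ‖(ξ' + η) + (ξ - ξ')‖ := by congr 1; abel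
    _ ≤ ‖ξ' + η‖ + ‖ξ - ξ'‖ := norm_add_le _ _

theorem continuous_distToSubdiff (hΨnn : ∀ v, 0 ≤ Ψ v) : Continuous (distToSubdiff Ψ) := by
  refine (LipschitzWith.of_le_add fun ξ ξ' => ?_).continuous
  rw [dist_eq_norm]
  exact distToSubdiff_le_add hΨnn ξ ξ'

/-- A sandwich (Hahn–Banach) bound: if `ξ + Ψ` is bounded below by `-r ‖·‖`, then the dual
distance from `-ξ` to `∂Ψ(0)` is at most `r`. -/
theorem distToSubdiff_le_of_forall [FiniteDimensional ℝ X] (hΨconv : ConvexOn ℝ Set.univ Ψ)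
    (hΨhom : ∀ c : ℝ, 0 ≤ c → ∀ v : X, Ψ (c • v) = c * Ψ v)
    {ξ : X →L[ℝ] ℝ} {r : ℝ} (hr : 0 ≤ r) (h : ∀ v, 0 ≤ ξ v + Ψ v + r * ‖v‖) :
    distToSubdiff Ψ ξ ≤ r := by
  let D : Submodule ℝ (X × X) := LinearMap.eqLocus (LinearMap.fst ℝ X X) (LinearMap.snd ℝ X X)
  let f : (X × X) →ₗ.[ℝ] ℝ := ⟨D, (-(ξ.toLinearMap ∘ₗ LinearMap.fst ℝ X X)).domRestrict D⟩
  have hΨ0 : Ψ 0 = 0 := by simpa using hΨhom 0 le_rfl 0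
  obtain ⟨F, hF, hFle⟩ := exists_extension_of_le_sublinear f (fun p => Ψ p.1 + r * ‖p.2‖)
    (fun c hc p => by
      simp only [Prod.smul_fst, Prod.smul_snd, hΨhom c hc.le, norm_smul, Real.norm_eq_abs,
        abs_of_pos hc]
      ring)
    (fun p q => by
      have h1 := sublinear_add_le hΨconv hΨhom p.1 q.1
      have h2 := mul_le_mul_of_nonneg_left (norm_add_le p.2 q.2) hr
      simp only [Prod.fst_add, Prod.snd_add]
      linarith)
    (by
      rintro ⟨⟨v, w⟩, hvw⟩
      obtain rfl : v = w := hvw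
      have := h v
      change -ξ v ≤ Ψ v + r * ‖v‖
      linarith)
  have hdiag : ∀ v, F (v, v) = -ξ v := fun v => hF ⟨(v, v), rfl⟩
  let η : X →L[ℝ] ℝ := LinearMap.toContinuousLinearMap (F ∘ₗ LinearMap.inl ℝ X X)
  have hη : ∀ v, η v = F (v, 0) := fun v => rfl
  have hsum : ∀ v, ξ v + η v = -F (0, v) := fun v => by
    have h1 : F (v, v) = F (v, 0) + F (0, v) := by rw [← map_add]; simp
    rw [hη]
    linarith [hdiag v]
  refine (csInf_le (bddBelow_norm_add_image _ _) ⟨η, fun v => ?_, rfl⟩).trans ?_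
  · simpa [hη] using hFle (v, 0)
  · refine ContinuousLinearMap.opNorm_le_bound _ hr fun v => ?_
    have h1 := hFle (0, v)
    have h2 := hFle (0, -v)
    have h3 : F (0, -v) = -F (0, v) := by rw [← map_neg]; simp
    simp only [hΨ0, norm_neg, zero_add] at h1 h2
    rw [add_apply, hsum, Real.norm_eq_abs, abs_le]
    constructor <;> linarith

/-- First-order optimality for the minimization of `f + Ψ(· - p)` over the closed ball
of radius `ε` around `p`. -/
theorem dissipation_add_dist_mul_norm_le [FiniteDimensional ℝ X]
    (hΨconv : ConvexOn ℝ Set.univ Ψ)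
    (hΨhom : ∀ c : ℝ, 0 ≤ c → ∀ v : X, Ψ (c • v) = c * Ψ v)
    {f : X → ℝ} {ξ : X →L[ℝ] ℝ} {p q : X} {ε : ℝ} (hε : 0 < ε) (hf : HasFDerivAt f ξ q)
    (hq : ‖q - p‖ ≤ ε) (hmin : ∀ x, ‖x - p‖ ≤ ε → f q + Ψ (q - p) ≤ f x + Ψ (x - p)) :
    Ψ (q - p) + distToSubdiff Ψ ξ * ‖q - p‖ ≤ -ξ (q - p) := by
  have hΨ0 : Ψ 0 = 0 := by simpa using hΨhom 0 le_rfl 0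
  have hvar : ∀ v, ‖v‖ ≤ ε → ξ (q - p) + Ψ (q - p) ≤ ξ v + Ψ v := by
    intro v hv
    have hlim : Tendsto (fun s : ℝ => s⁻¹ • (f (q + s • (v - (q - p))) - f q)) (𝓝[>] 0)
        (𝓝 (ξ (v - (q - p)))) := by
      have h0 := (hf.hasLineDerivAt (v - (q - p))).tendsto_slope_zero_right
      simpa using h0
    have hle : Ψ (q - p) - Ψ v ≤ ξ (v - (q - p)) := by
      refine ge_of_tendsto hlim ?_
      filter_upwards [Ioc_mem_nhdsGT (zero_lt_one' ℝ)] with s hs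
      have hcomb : q + s • (v - (q - p)) - p = (1 - s) • (q - p) + s • v := by module
      have hball : ‖q + s • (v - (q - p)) - p‖ ≤ ε := by
        rw [hcomb]
        refine (norm_add_le _ _).trans ?_
        rw [norm_smul, norm_smul, Real.norm_of_nonneg hs.1.le,
          Real.norm_of_nonneg (sub_nonneg.2 hs.2)]
        nlinarith [mul_le_mul_of_nonneg_left hv hs.1.le,
          mul_le_mul_of_nonneg_left hq (sub_nonneg.2 hs.2)]
      have h1 := hmin _ hball
      have h2 := hΨconv.2 (mem_univ (q - p)) (mem_univ v) (sub_nonneg.2 hs.2) hs.1.le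
        (by ring)
      rw [hcomb] at h1
      simp only [smul_eq_mul] at h2 ⊢
      rw [inv_mul_eq_div, le_div_iff₀ hs.1]
      linarith
    rw [map_sub] at hle
    linarith
  set m := ξ (q - p) + Ψ (q - p) with hm
  have hm0 : m ≤ 0 := by simpa [hΨ0] using hvar 0 (by simpa using hε.le)
  have hd : distToSubdiff Ψ ξ ≤ -m / ε := by
    refine distToSubdiff_le_of_forall hΨconv hΨhom (div_nonneg (by linarith) hε.le) fun v => ?_
    rcases eq_or_ne v 0 with rfl | hv
    · simp [hΨ0]
    · have hv' : 0 < ‖v‖ := norm_pos_iff.2 hv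
      have h1 := hvar ((ε / ‖v‖) • v) (by
        rw [norm_smul, Real.norm_of_nonneg (by positivity), div_mul_cancel₀ _ hv'.ne'])
      rw [map_smul, hΨhom _ (by positivity), smul_eq_mul, ← mul_add, div_mul_eq_mul_div,
        le_div_iff₀ hv'] at h1
      have h2 : ε * (ξ v + Ψ v + -m / ε * ‖v‖) = ε * (ξ v + Ψ v) - m * ‖v‖ := by
        field_simp
        ring
      exact nonneg_of_mul_nonneg_right (by rw [h2]; linarith) hε
  have h1 : distToSubdiff Ψ ξ * ‖q - p‖ ≤ distToSubdiff Ψ ξ * ε :=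
    mul_le_mul_of_nonneg_left hq (distToSubdiff_nonneg ξ)
  rw [le_div_iff₀ hε] at hd
  linarith

theorem exists_pos_mul_norm_le_of_sublinear [FiniteDimensional ℝ X]
    (hΨconv : ConvexOn ℝ Set.univ Ψ)
    (hΨhom : ∀ c : ℝ, 0 ≤ c → ∀ v : X, Ψ (c • v) = c * Ψ v)
    (hΨpos : ∀ v : X, v ≠ 0 → 0 < Ψ v) :
    ∃ c C : ℝ, 0 < c ∧ ∀ v, c * ‖v‖ ≤ Ψ v ∧ Ψ v ≤ C * ‖v‖ := by
  have hcont : Continuous Ψ := continuousOn_univ.1 (hΨconv.continuousOn isOpen_univ)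
  have hΨ0 : Ψ 0 = 0 := by simpa using hΨhom 0 le_rfl 0
  have hcomp : IsCompact (Metric.sphere (0 : X) 1) := isCompact_sphere 0 1
  rcases (Metric.sphere (0 : X) 1).eq_empty_or_nonempty with he | hne
  · refine ⟨1, 0, one_pos, fun v => ?_⟩
    obtain rfl : v = 0 := by
      by_contra hv
      have : (‖v‖⁻¹ • v) ∈ Metric.sphere (0 : X) 1 := by
        simp [norm_smul, norm_ne_zero_iff.2 hv]
      simp [he] at this
    simp [hΨ0]
  · obtain ⟨a, ha, hamin⟩ := hcomp.exists_isMinOn hne hcont.continuousOn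
    obtain ⟨b, hb, hbmax⟩ := hcomp.exists_isMaxOn hne hcont.continuousOn
    have ha0 : a ≠ 0 := by
      rintro rfl
      simp at ha
    refine ⟨Ψ a, Ψ b, hΨpos a ha0, fun v => ?_⟩
    rcases eq_or_ne v 0 with rfl | hv
    · simp [hΨ0]
    · have hv' : 0 < ‖v‖ := norm_pos_iff.2 hv
      have hmem : (‖v‖⁻¹ • v) ∈ Metric.sphere (0 : X) 1 := by
        simp [norm_smul, hv'.ne']
      have h1 : Ψ a ≤ Ψ (‖v‖⁻¹ • v) := hamin hmem
      have h2 : Ψ (‖v‖⁻¹ • v) ≤ Ψ b := hbmax hmem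
      rw [hΨhom _ (by positivity), inv_mul_eq_div] at h1 h2
      exact ⟨(le_div_iff₀ hv').1 h1, (div_le_iff₀ hv').1 h2⟩

end Dissipation

/-- Two-sided Grönwall bound for a nonnegative function with `|f'| ≤ lam * f`. -/
theorem exp_bounds_of_abs_deriv_le {f f' : ℝ → ℝ} {lam T : ℝ}
    (hf : ∀ t ∈ Icc (0 : ℝ) T, HasDerivWithinAt f (f' t) (Icc 0 T) t)
    (hb : ∀ t ∈ Icc (0 : ℝ) T, |f' t| ≤ lam * f t)
    {s t : ℝ} (hs : s ∈ Icc (0 : ℝ) T) (ht : t ∈ Icc (0 : ℝ) T) (hst : s ≤ t) :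
    f t ≤ Real.exp (lam * (t - s)) * f s ∧ f s ≤ Real.exp (lam * (t - s)) * f t := by
  have hd : ∀ σ : ℝ, ∀ r ∈ Icc (0 : ℝ) T, HasDerivWithinAt (fun r => Real.exp (σ * r) * f r)
      (Real.exp (σ * r) * (σ * f r + f' r)) (Icc 0 T) r := by
    intro σ r hr
    have h1 : HasDerivAt (fun r : ℝ => Real.exp (σ * r)) (Real.exp (σ * r) * (σ * 1)) r :=
      ((hasDerivAt_id r).const_mul σ).exp
    exact (h1.hasDerivWithinAt.mul (hf r hr)).congr_deriv (by ring)
  have hint : ∀ σ : ℝ, ∀ r ∈ interior (Icc (0 : ℝ) T),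
      HasDerivAt (fun r => Real.exp (σ * r) * f r)
        (Real.exp (σ * r) * (σ * f r + f' r)) r := fun σ r hr =>
    (hd σ r (interior_subset hr)).hasDerivAt (mem_interior_iff_mem_nhds.1 hr)
  have hanti : AntitoneOn (fun r => Real.exp (-lam * r) * f r) (Icc 0 T) := by
    refine antitoneOn_of_deriv_nonpos (convex_Icc 0 T)
      (fun r hr => (hd _ r hr).continuousWithinAt)
      (fun r hr => (hint _ r hr).differentiableAt.differentiableWithinAt) fun r hr => ?_
    rw [(hint _ r hr).deriv]
    have := (abs_le.1 (hb r (interior_subset hr))).2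
    exact mul_nonpos_of_nonneg_of_nonpos (Real.exp_pos _).le (by linarith)
  have hmono : MonotoneOn (fun r => Real.exp (lam * r) * f r) (Icc 0 T) := by
    refine monotoneOn_of_deriv_nonneg (convex_Icc 0 T)
      (fun r hr => (hd _ r hr).continuousWithinAt)
      (fun r hr => (hint _ r hr).differentiableAt.differentiableWithinAt) fun r hr => ?_
    rw [(hint _ r hr).deriv]
    have := (abs_le.1 (hb r (interior_subset hr))).1
    exact mul_nonneg (Real.exp_pos _).le (by linarith)
  have h1 := hanti hs ht hst
  have h2 := hmono hs ht hst
  constructor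
  · have h3 := mul_le_mul_of_nonneg_left h1 (Real.exp_pos (lam * t)).le
    simp only [← mul_assoc, ← Real.exp_add] at h3
    rwa [show lam * t + -lam * t = 0 by ring, Real.exp_zero, one_mul,
      show lam * t + -lam * s = lam * (t - s) by ring] at h3
  · have h3 := mul_le_mul_of_nonneg_left h2 (Real.exp_pos (-lam * s)).le
    simp only [← mul_assoc, ← Real.exp_add] at h3
    rwa [show -lam * s + lam * s = 0 by ring, Real.exp_zero, one_mul,
      show -lam * s + lam * t = lam * (t - s) by ring] at h3

section Paths

variable {X : Type*} [NormedAddCommGroup X] [NormedSpace ℝ X] {Ψ g : X → ℝ}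

/-- `a` and `b` are joined by a Lipschitz path on `[0,1]` whose weighted length density
`Ψ(γ') + g(γ)‖γ'‖` is integrable with integral at most `c`. -/
def HasPathCostLE (Ψ g : X → ℝ) (a b : X) (c : ℝ) : Prop :=
  ∃ (K : ℝ≥0) (γ : ℝ → X), LipschitzOnWith K γ (Icc 0 1) ∧ γ 0 = a ∧ γ 1 = b ∧
    IntervalIntegrable (fun s => Ψ (deriv γ s) + g (γ s) * ‖deriv γ s‖) volume 0 1 ∧
    ∫ s in (0:ℝ)..1, (Ψ (deriv γ s) + g (γ s) * ‖deriv γ s‖) ≤ c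

theorem HasPathCostLE.mono {a b : X} {c c' : ℝ} (h : HasPathCostLE Ψ g a b c) (hc : c ≤ c') :
    HasPathCostLE Ψ g a b c' := by
  obtain ⟨K, γ, h1, h2, h3, h4, h5⟩ := h
  exact ⟨K, γ, h1, h2, h3, h4, h5.trans hc⟩

theorem hasPathCostLE_segment (hg : Continuous g) {a b : X} {B : ℝ}
    (hB : ∀ x ∈ segment ℝ a b, g x ≤ B) :
    HasPathCostLE Ψ g a b (Ψ (b - a) + B * ‖b - a‖) := by
  have hder : ∀ s : ℝ, deriv (AffineMap.lineMap a b : ℝ → X) s = b - a := fun s =>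
    AffineMap.hasDerivAt_lineMap.deriv
  have hcont : Continuous fun s : ℝ =>
      Ψ (b - a) + g (AffineMap.lineMap a b s) * ‖b - a‖ := by
    have := hg.comp (AffineMap.lineMap_continuous (p := a) (q := b) (R := ℝ))
    fun_prop
  refine ⟨nndist a b, AffineMap.lineMap a b, (lipschitzWith_lineMap a b).lipschitzOnWith,
    by simp, by simp, ?_, ?_⟩
  · simpa only [hder] using hcont.intervalIntegrable 0 1
  · simp only [hder]
    have := intervalIntegral.integral_mono_on zero_le_one (hcont.intervalIntegrable 0 1)
      (intervalIntegrable_const (μ := volume) (c := Ψ (b - a) + B * ‖b - a‖)) fun s hs => by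
        have hmem : AffineMap.lineMap a b s ∈ segment ℝ a b :=
          segment_eq_image_lineMap ℝ a b ▸ mem_image_of_mem _ hs
        have := mul_le_mul_of_nonneg_right (hB _ hmem) (norm_nonneg (b - a))
        linarith
    simpa using this

theorem HasPathCostLE.trans (hΨhom : ∀ c : ℝ, 0 ≤ c → ∀ v : X, Ψ (c • v) = c * Ψ v)
    {a b d : X} {c c' : ℝ}
    (h : HasPathCostLE Ψ g a b c) (h' : HasPathCostLE Ψ g b d c') :
    HasPathCostLE Ψ g a d (c + c') := by
  obtain ⟨K, γ, hK, h0, h1, hi, hc⟩ := h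
  obtain ⟨K', γ', hK', h0', h1', hi', hc'⟩ := h'
  let G : (ℝ → X) → ℝ → ℝ := fun γ s => Ψ (deriv γ s) + g (γ s) * ‖deriv γ s‖
  let Γ : ℝ → X := fun s => if s ≤ 1 / 2 then γ (2 * s) else γ' (2 * s - 1)
  have hleft : ∀ s ≤ 1 / 2, Γ s = γ (2 * s) := fun s hs => if_pos hs
  have hright : ∀ s, 1 / 2 ≤ s → Γ s = γ' (2 * s - 1) := by
    intro s hs
    rcases hs.eq_or_lt with rfl | hs
    · rw [hleft _ le_rfl]
      norm_num [h1, h0']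
    · exact if_neg hs.not_ge
  have hGscale : ∀ (δ : ℝ → X) (s r : ℝ), Γ s = δ r → deriv Γ s = (2 : ℝ) • deriv δ r →
      G Γ s = 2 * G δ r := by
    intro δ s r hv hd
    simp only [G, hv, hd, hΨhom 2 zero_le_two, norm_smul, Real.norm_ofNat]
    ring
  have hGl : EqOn (fun s => 2 * G γ (2 * s)) (G Γ) (uIoo 0 (1 / 2)) := by
    intro s hs
    rw [uIoo_of_le (by norm_num)] at hs
    refine (hGscale γ s (2 * s) (hleft s hs.2.le) ?_).symm
    have : Γ =ᶠ[𝓝 s] fun r => γ (2 * r) := by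
      filter_upwards [Iio_mem_nhds hs.2] with r hr using hleft r (le_of_lt hr)
    rw [this.deriv_eq, deriv_comp_mul_left]
  have hGr : EqOn (fun s => 2 * G γ' (2 * s - 1)) (G Γ) (uIoo (1 / 2) 1) := by
    intro s hs
    rw [uIoo_of_le (by norm_num)] at hs
    refine (hGscale γ' s (2 * s - 1) (hright s hs.1.le) ?_).symm
    have : Γ =ᶠ[𝓝 s] fun r => γ' (2 * r - 1) := by
      filter_upwards [Ioi_mem_nhds hs.1] with r hr using hright r (le_of_lt hr)
    rw [this.deriv_eq, deriv_comp_mul_left 2 (fun r => γ' (r - 1)), deriv_comp_sub_const]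
  have hil : IntervalIntegrable (G Γ) volume 0 (1 / 2) := by
    refine IntervalIntegrable.congr_uIoo ?_ hGl
    have := (IntervalIntegrable.comp_mul_left (c := 2) hi).const_mul 2
    simpa using this
  have hir : IntervalIntegrable (G Γ) volume (1 / 2) 1 := by
    refine IntervalIntegrable.congr_uIoo ?_ hGr
    have := (IntervalIntegrable.comp_mul_left (c := 2)
      (IntervalIntegrable.comp_sub_right hi' 1)).const_mul 2
    convert this using 1 <;> norm_num
  refine ⟨2 * max K K', Γ, ?_, by rw [hleft _ (by norm_num)]; simpa using h0,
    by rw [hright _ (by norm_num)]; norm_num [h1'], hil.trans hir, ?_⟩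
  · have hl : ∀ x ∈ Icc (0 : ℝ) (1 / 2), ∀ y ∈ Icc (0 : ℝ) (1 / 2), x ≤ y →
        dist (Γ x) (Γ y) ≤ 2 * (max K K' : ℝ≥0) * (y - x) := by
      intro x hx y hy hxy
      rw [hleft x hx.2, hleft y hy.2]
      refine (hK.dist_le_mul (2 * x) ⟨by linarith [hx.1], by linarith [hx.2]⟩ (2 * y)
        ⟨by linarith [hy.1], by linarith [hy.2]⟩).trans ?_
      rw [dist_comm, Real.dist_eq, abs_of_nonneg (by linarith)]
      have hKm : (K : ℝ) ≤ max K K' := NNReal.coe_le_coe.2 (le_max_left K K')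
      linarith [mul_le_mul_of_nonneg_right hKm (sub_nonneg.2 hxy)]
    have hr : ∀ x ∈ Icc (1 / 2 : ℝ) 1, ∀ y ∈ Icc (1 / 2 : ℝ) 1, x ≤ y →
        dist (Γ x) (Γ y) ≤ 2 * (max K K' : ℝ≥0) * (y - x) := by
      intro x hx y hy hxy
      rw [hright x hx.1, hright y hy.1]
      refine (hK'.dist_le_mul (2 * x - 1) ⟨by linarith [hx.1], by linarith [hx.2]⟩ (2 * y - 1)
        ⟨by linarith [hy.1], by linarith [hy.2]⟩).trans ?_
      rw [dist_comm, Real.dist_eq, abs_of_nonneg (by linarith)]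
      have hKm : (K' : ℝ) ≤ max K K' := NNReal.coe_le_coe.2 (le_max_right K K')
      linarith [mul_le_mul_of_nonneg_right hKm (sub_nonneg.2 hxy)]
    have hall : ∀ x ∈ Icc (0 : ℝ) 1, ∀ y ∈ Icc (0 : ℝ) 1, x ≤ y →
        dist (Γ x) (Γ y) ≤ 2 * (max K K' : ℝ≥0) * (y - x) := by
      intro x hx y hy hxy
      rcases le_total y (1 / 2) with hy2 | hy2
      · exact hl x ⟨hx.1, hxy.trans hy2⟩ y ⟨hy.1, hy2⟩ hxy
      · rcases le_total x (1 / 2) with hx2 | hx2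
        · have e1 := hl x ⟨hx.1, hx2⟩ (1 / 2) (by norm_num) hx2
          have e2 := hr (1 / 2) (by norm_num) y ⟨hy2, hy.2⟩ hy2
          linarith [dist_triangle (Γ x) (Γ (1 / 2)) (Γ y)]
        · exact hr x ⟨hx2, hx.2⟩ y ⟨hy2, hy.2⟩ hxy
    refine LipschitzOnWith.of_dist_le_mul fun x hx y hy => ?_
    push_cast
    rcases le_total x y with hxy | hxy
    · rw [dist_comm x y, Real.dist_eq, abs_of_nonneg (sub_nonneg.2 hxy)]
      exact hall x hx y hy hxy
    · rw [dist_comm, Real.dist_eq, abs_of_nonneg (sub_nonneg.2 hxy)]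
      exact hall y hy x hx hxy
  · change ∫ s in (0:ℝ)..1, G Γ s ≤ c + c'
    rw [← intervalIntegral.integral_add_adjacent_intervals hil hir,
      ← intervalIntegral.integral_congr_uIoo hGl, ← intervalIntegral.integral_congr_uIoo hGr]
    refine add_le_add (le_of_eq_of_le ?_ hc) (le_of_eq_of_le ?_ hc')
    · rw [intervalIntegral.integral_const_mul, intervalIntegral.integral_comp_mul_left _ two_ne_zero]
      norm_num [G, ← mul_assoc]
    · rw [intervalIntegral.integral_const_mul, intervalIntegral.integral_comp_mul_sub _ two_ne_zero]
      norm_num [G, ← mul_assoc]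

theorem HasPathCostLE.deltaNew_le {DE : ℝ → X → X →L[ℝ] ℝ} (hΨnn : ∀ v, 0 ≤ Ψ v) {t : ℝ}
    {a b : X} {c : ℝ} (h : HasPathCostLE Ψ (fun x => distToSubdiff Ψ (DE t x)) a b c) :
    deltaNew DE Ψ t a b ≤ c := by
  obtain ⟨K, γ, hK, h0, h1, -, hc⟩ := h
  refine le_trans (csInf_le ⟨0, ?_⟩ ⟨K, γ, hK, h0, h1, rfl⟩) hc
  rintro _ ⟨K, γ, -, -, -, rfl⟩
  exact intervalIntegral.integral_nonneg zero_le_one fun s _ =>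
    add_nonneg (hΨnn _) (mul_nonneg (distToSubdiff_nonneg _) (norm_nonneg _))

end Paths

section Polygon

variable {X : Type*} [NormedAddCommGroup X]

/-- The length of the polygon through the first `i + 1` points of a sequence. -/
def polygonLength (pts : ℕ → X) (i : ℕ) : ℝ :=
  ∑ l ∈ Finset.range i, ‖pts (l + 1) - pts l‖

theorem polygonLength_succ (pts : ℕ → X) (i : ℕ) :
    polygonLength pts (i + 1) = polygonLength pts i + ‖pts (i + 1) - pts i‖ :=
  Finset.sum_range_succ _ _

theorem polygonLength_nonneg (pts : ℕ → X) (i : ℕ) : 0 ≤ polygonLength pts i :=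
  Finset.sum_nonneg fun _ _ => norm_nonneg _

theorem norm_sub_zero_le_polygonLength (pts : ℕ → X) (i : ℕ) :
    ‖pts i - pts 0‖ ≤ polygonLength pts i := by
  induction i with
  | zero => simp [polygonLength]
  | succ i ih =>
    rw [polygonLength_succ]
    linarith [norm_sub_le_norm_sub_add_norm_sub (pts (i + 1)) (pts i) (pts 0)]

end Polygon

theorem mul_mem_Icc_of_le {τ T : ℝ} {N : ℕ} (hτ : 0 < τ) (hN : (N : ℝ) * τ ≤ T)
    {i : ℕ} (hi : i ≤ N) : (i : ℝ) * τ ∈ Icc 0 T :=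
  ⟨by positivity, (mul_le_mul_of_nonneg_right (Nat.cast_le.2 hi) hτ.le).trans hN⟩

/-- The weighted energy at a node controls the weighted energy before the next jump. -/
theorem exp_neg_mul_energy_le {X : Type*} {E : ℝ → X → ℝ} {τ T lam : ℝ} {N : ℕ}
    (hgr : ∀ x, ∀ s ∈ Icc 0 T, ∀ t ∈ Icc 0 T, s ≤ t →
      E t x ≤ Real.exp (lam * (t - s)) * E s x)
    (hτ : 0 < τ) (hN : (N : ℝ) * τ ≤ T) {i : ℕ} (hi : i + 1 ≤ N) (x : X) :
    Real.exp (-lam * ((i + 1 : ℕ) * τ)) * E ((i + 1 : ℕ) * τ) x ≤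
      Real.exp (-lam * (i * τ)) * E (i * τ) x := by
  have h := hgr x _ (mul_mem_Icc_of_le hτ hN (Nat.le_of_succ_le hi)) _
    (mul_mem_Icc_of_le hτ hN hi) (by push_cast; nlinarith)
  refine (mul_le_mul_of_nonneg_left h (Real.exp_pos _).le).trans_eq ?_
  rw [← mul_assoc, ← Real.exp_add]
  congr 2
  ring

section Discrete

variable {X : Type*} [NormedAddCommGroup X] [NormedSpace ℝ X]
  {E : ℝ → X → ℝ} {DE : ℝ → X → X →L[ℝ] ℝ} {Ψ : X → ℝ} {x₀ : X} {ε τ T lam c : ℝ} {N : ℕ}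
  {pts : ℕ → X}

theorem IsDiscreteSol.energy_add_dissipation_le (hsol : IsDiscreteSol E Ψ x₀ ε τ N pts)
    (hε : 0 < ε) (hΨhom : ∀ c : ℝ, 0 ≤ c → ∀ v : X, Ψ (c • v) = c * Ψ v)
    {i : ℕ} (hi : i + 1 ≤ N) :
    E ((i + 1 : ℕ) * τ) (pts (i + 1)) + Ψ (pts (i + 1) - pts i) ≤
      E ((i + 1 : ℕ) * τ) (pts i) := by
  have h := (hsol.2 (i + 1) (by omega) hi).2 (pts i) (by simpa using hε.le)
  have hΨ0 : Ψ 0 = 0 := by simpa using hΨhom 0 le_rfl 0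
  simpa [hΨ0] using h

theorem IsDiscreteSol.energy_add_length_le (hsol : IsDiscreteSol E Ψ x₀ ε τ N pts)
    (hε : 0 < ε) (hΨhom : ∀ c : ℝ, 0 ≤ c → ∀ v : X, Ψ (c • v) = c * Ψ v)
    (hlam : 0 ≤ lam) (hc : 0 < c) (hcΨ : ∀ v, c * ‖v‖ ≤ Ψ v)
    (hgr : ∀ x, ∀ s ∈ Icc 0 T, ∀ t ∈ Icc 0 T, s ≤ t →
      E t x ≤ Real.exp (lam * (t - s)) * E s x)
    (hτ : 0 < τ) (hN : (N : ℝ) * τ ≤ T) {i : ℕ} (hi : i ≤ N) :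
    Real.exp (-lam * (i * τ)) * E (i * τ) (pts i) +
      Real.exp (-lam * T) * (c * polygonLength pts i) ≤ E 0 x₀ := by
  induction i with
  | zero => simp [polygonLength, hsol.1]
  | succ i ih =>
    have h0 := ih (Nat.le_of_succ_le hi)
    have h1 := exp_neg_mul_energy_le hgr hτ hN hi (pts i)
    have h2 := mul_le_mul_of_nonneg_left (hsol.energy_add_dissipation_le hε hΨhom hi)
      (Real.exp_pos (-lam * ((i + 1 : ℕ) * τ))).le
    have hT := (mul_mem_Icc_of_le hτ hN hi).2
    have h3 : Real.exp (-lam * T) * (c * ‖pts (i + 1) - pts i‖) ≤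
        Real.exp (-lam * ((i + 1 : ℕ) * τ)) * Ψ (pts (i + 1) - pts i) :=
      mul_le_mul (Real.exp_le_exp.2 (by nlinarith)) (hcΨ _) (by positivity) (Real.exp_pos _).le
    rw [polygonLength_succ]
    linarith

theorem IsDiscreteSol.polygonLength_le (hsol : IsDiscreteSol E Ψ x₀ ε τ N pts)
    (hε : 0 < ε) (hΨhom : ∀ c : ℝ, 0 ≤ c → ∀ v : X, Ψ (c • v) = c * Ψ v)
    (hEnn : ∀ t ∈ Icc (0 : ℝ) T, ∀ x : X, 0 ≤ E t x)
    (hlam : 0 ≤ lam) (hc : 0 < c) (hcΨ : ∀ v, c * ‖v‖ ≤ Ψ v)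
    (hgr : ∀ x, ∀ s ∈ Icc 0 T, ∀ t ∈ Icc 0 T, s ≤ t →
      E t x ≤ Real.exp (lam * (t - s)) * E s x)
    (hτ : 0 < τ) (hN : (N : ℝ) * τ ≤ T) {i : ℕ} (hi : i ≤ N) :
    polygonLength pts i ≤ Real.exp (lam * T) * E 0 x₀ / c := by
  have h := hsol.energy_add_length_le hε hΨhom hlam hc hcΨ hgr hτ hN hi
  have h0 := mul_nonneg (Real.exp_pos (-lam * (i * τ))).le
    (hEnn _ (mul_mem_Icc_of_le hτ hN hi) (pts i))
  rw [le_div_iff₀ hc, mul_comm _ c]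
  have h1 := mul_le_mul_of_nonneg_left (le_of_add_le_of_nonneg_right h h0)
    (Real.exp_pos (lam * T)).le
  rwa [← mul_assoc, ← Real.exp_add, show lam * T + -lam * T = 0 by ring, Real.exp_zero,
    one_mul] at h1

/-- A single step of the scheme, joined by its segment, costs at most the energy drop up to
an error proportional to its length. -/
theorem hasPathCostLE_step [FiniteDimensional ℝ X] (hΨnn : ∀ v, 0 ≤ Ψ v)
    (hΨconv : ConvexOn ℝ Set.univ Ψ)
    (hΨhom : ∀ c : ℝ, 0 ≤ c → ∀ v : X, Ψ (c • v) = c * Ψ v)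
    {s t η : ℝ} {p q : X} (hε : 0 < ε) (hDEs : ∀ x, HasFDerivAt (E s) (DE s x) x)
    (hDEt : Continuous (DE t))
    (hq : ‖q - p‖ ≤ ε)
    (hmin : ∀ x, ‖x - p‖ ≤ ε → E s q + Ψ (q - p) ≤ E s x + Ψ (x - p))
    (hs : ∀ x ∈ segment ℝ p q, ‖DE s x - DE s q‖ ≤ η)
    (ht : ∀ x ∈ segment ℝ p q, ‖DE t x - DE s q‖ ≤ η) :
    HasPathCostLE Ψ (fun x => distToSubdiff Ψ (DE t x)) p q
      (E s p - E s q + 2 * η * ‖q - p‖) := by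
  have hopt := dissipation_add_dist_mul_norm_le hΨconv hΨhom hε (hDEs q) hq hmin
  have hmv := (convex_segment p q).norm_image_sub_le_of_norm_hasFDerivWithin_le'
    (fun x _ => (hDEs x).hasFDerivWithinAt) hs (right_mem_segment ℝ p q)
    (left_mem_segment ℝ p q)
  rw [norm_sub_rev p q, Real.norm_eq_abs] at hmv
  have hmv' := (abs_le.1 hmv).1
  have hneg : DE s q (p - q) = -DE s q (q - p) := by rw [← map_neg, neg_sub]
  refine (hasPathCostLE_segment ((continuous_distToSubdiff hΨnn).comp hDEt)
    (B := distToSubdiff Ψ (DE s q) + η) fun x hx => ?_).mono ?_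
  · exact (distToSubdiff_le_add hΨnn _ (DE s q)).trans (by gcongr; exact ht x hx)
  · rw [hneg] at hmv'
    linarith

theorem IsDiscreteSol.hasPathCostLE [FiniteDimensional ℝ X]
    (hsol : IsDiscreteSol E Ψ x₀ ε τ N pts)
    (hΨnn : ∀ v, 0 ≤ Ψ v) (hΨconv : ConvexOn ℝ Set.univ Ψ)
    (hΨhom : ∀ c : ℝ, 0 ≤ c → ∀ v : X, Ψ (c • v) = c * Ψ v)
    {t η R : ℝ} (hε : 0 < ε)
    (hDE : ∀ s ∈ Icc (0 : ℝ) T, ∀ x : X, HasFDerivAt (E s) (DE s x) x)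
    (hDEt : Continuous (DE t)) (hlam : 0 ≤ lam)
    (hgr : ∀ x, ∀ s ∈ Icc 0 T, ∀ t ∈ Icc 0 T, s ≤ t →
      E t x ≤ Real.exp (lam * (t - s)) * E s x)
    (hτ : 0 < τ) (hN : (N : ℝ) * τ ≤ T) {j i : ℕ} (hji : j ≤ i) (hi : i ≤ N)
    (hit : i * τ ≤ t)
    (hR : ∀ l ≤ N, pts l ∈ Metric.closedBall x₀ R)
    (hmod : ∀ s ∈ Icc ((j + 1 : ℕ) * τ) t, s ∈ Icc 0 T → ∀ r ∈ ({s, t} : Set ℝ),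
      ∀ x ∈ Metric.closedBall x₀ R, ∀ y ∈ Metric.closedBall x₀ R, ‖x - y‖ ≤ ε →
      ‖DE r x - DE s y‖ ≤ η) :
    HasPathCostLE Ψ (fun x => distToSubdiff Ψ (DE t x)) (pts j) (pts i)
      (Real.exp (lam * t) * (Real.exp (-lam * (j * τ)) * E (j * τ) (pts j) -
        Real.exp (-lam * (i * τ)) * E (i * τ) (pts i)) +
        2 * η * (polygonLength pts i - polygonLength pts j)) := by
  induction i, hji using Nat.le_induction with
  | base =>
    have hΨ0 : Ψ 0 = 0 := by simpa using hΨhom 0 le_rfl 0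
    refine (hasPathCostLE_segment (Ψ := Ψ) ((continuous_distToSubdiff hΨnn).comp hDEt)
      (B := distToSubdiff Ψ (DE t (pts j))) fun x hx => ?_).mono ?_
    · rw [segment_same, mem_singleton_iff] at hx
      rw [hx, Function.comp_apply]
    · simp [hΨ0]
  | succ i hji ih =>
    have hi' : i ≤ N := Nat.le_of_succ_le hi
    have hit' : (i : ℝ) * τ ≤ t := by push_cast at hit; linarith
    have hsI := mul_mem_Icc_of_le hτ hN hi
    obtain ⟨hq, hmin⟩ := hsol.2 (i + 1) (by omega) hi
    rw [Nat.add_sub_cancel] at hq hmin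
    have hst : ((i + 1 : ℕ) : ℝ) * τ ∈ Icc ((j + 1 : ℕ) * τ) t :=
      ⟨mul_le_mul_of_nonneg_right (Nat.cast_le.2 (by omega)) hτ.le, hit⟩
    have hseg : ∀ x ∈ segment ℝ (pts i) (pts (i + 1)),
        x ∈ Metric.closedBall x₀ R ∧ ‖x - pts (i + 1)‖ ≤ ε := fun x hx =>
      ⟨(convex_closedBall x₀ R).segment_subset (hR i hi') (hR (i + 1) hi) hx, by
        have hball : segment ℝ (pts i) (pts (i + 1)) ⊆ Metric.closedBall (pts (i + 1)) ε :=
          (convex_closedBall _ _).segment_subset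
            (by rwa [mem_closedBall_iff_norm, norm_sub_rev])
            (Metric.mem_closedBall_self hε.le)
        exact mem_closedBall_iff_norm.1 (hball hx)⟩
    have hstep := hasPathCostLE_step hΨnn hΨconv hΨhom hε (hDE _ hsI) hDEt hq hmin
      (fun x hx => hmod _ hst hsI _ (by simp) x (hseg x hx).1 _ (hR _ hi) (hseg x hx).2)
      (fun x hx => hmod _ hst hsI _ (by simp) x (hseg x hx).1 _ (hR _ hi) (hseg x hx).2)
    refine ((ih hi' hit').trans hΨhom hstep).mono ?_
    have h1 := exp_neg_mul_energy_le hgr hτ hN hi (pts i)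
    have h2 := hsol.energy_add_dissipation_le hε hΨhom hi
    have h3 : E ((i + 1 : ℕ) * τ) (pts i) - E ((i + 1 : ℕ) * τ) (pts (i + 1)) ≤
        Real.exp (lam * t) * (Real.exp (-lam * ((i + 1 : ℕ) * τ)) *
          (E ((i + 1 : ℕ) * τ) (pts i) - E ((i + 1 : ℕ) * τ) (pts (i + 1)))) := by
      rw [← mul_assoc, ← Real.exp_add]
      refine le_mul_of_one_le_left (by linarith [hΨnn (pts (i + 1) - pts i)])
        (Real.one_le_exp ?_)
      have := mul_le_mul_of_nonneg_left hit hlam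
      linarith
    have h4 := mul_le_mul_of_nonneg_left h1 (Real.exp_pos (lam * t)).le
    rw [polygonLength_succ]
    linarith

end Discrete

theorem discInterp_eq {X : Type*} [NormedAddCommGroup X] (pts : ℕ → X) {τ T s : ℝ} {N : ℕ}
    (hτ : 0 < τ) (hN : T < ((N : ℝ) + 1) * τ) (hs : s ∈ Icc 0 T) :
    discInterp pts τ N s = pts ⌊s / τ⌋₊ ∧ ⌊s / τ⌋₊ ≤ N ∧ (⌊s / τ⌋₊ : ℝ) * τ ≤ s ∧
      s < ((⌊s / τ⌋₊ : ℝ) + 1) * τ := by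
  have h1 : (⌊s / τ⌋₊ : ℝ) * τ ≤ s :=
    (le_div_iff₀ hτ).1 (Nat.floor_le (div_nonneg hs.1 hτ.le))
  have h2 : s < ((⌊s / τ⌋₊ : ℝ) + 1) * τ := (div_lt_iff₀ hτ).1 (Nat.lt_floor_add_one _)
  have h3 : ⌊s / τ⌋₊ ≤ N := by
    have h4 : (⌊s / τ⌋₊ : ℝ) < (N : ℝ) + 1 :=
      lt_of_mul_lt_mul_right (h1.trans_lt (hs.2.trans_lt hN)) hτ.le
    exact Nat.lt_succ_iff.1 (by exact_mod_cast h4)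
  exact ⟨by rw [discInterp, min_eq_right h3], h3, h1, h2⟩

/-- Joining `a` to the scheme at time `s`, following the scheme up to time `t`, and then joining
it to `b` bounds the jump cost from `a` to `b`. -/
theorem IsDiscreteSol.deltaNew_le {X : Type*} [NormedAddCommGroup X] [NormedSpace ℝ X]
    [FiniteDimensional ℝ X] {E : ℝ → X → ℝ} {DE : ℝ → X → X →L[ℝ] ℝ} {Ψ : X → ℝ} {x₀ : X}
    {ε τ T lam C B L R η : ℝ} {N : ℕ} {pts : ℕ → X}
    (hsol : IsDiscreteSol E Ψ x₀ ε τ N pts)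
    (hEnn : ∀ t ∈ Icc (0 : ℝ) T, ∀ x : X, 0 ≤ E t x)
    (hΨnn : ∀ v, 0 ≤ Ψ v) (hΨconv : ConvexOn ℝ Set.univ Ψ)
    (hΨhom : ∀ c : ℝ, 0 ≤ c → ∀ v : X, Ψ (c • v) = c * Ψ v)
    (hε : 0 < ε)
    (hDE : ∀ s ∈ Icc (0 : ℝ) T, ∀ x : X, HasFDerivAt (E s) (DE s x) x)
    (hlam : 0 ≤ lam)
    (hgr : ∀ x, ∀ s ∈ Icc 0 T, ∀ t ∈ Icc 0 T, s ≤ t →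
      E t x ≤ Real.exp (lam * (t - s)) * E s x ∧ E s x ≤ Real.exp (lam * (t - s)) * E t x)
    (hτ : 0 < τ) (hN : (N : ℝ) * τ ≤ T) (hN' : T < ((N : ℝ) + 1) * τ)
    {s t : ℝ} (hs : s ∈ Icc 0 T) (ht : t ∈ Icc 0 T) (hst : s < t)
    (hDEt : Continuous (DE t)) (hη : 0 ≤ η)
    (hCΨ : ∀ v, Ψ v ≤ C * ‖v‖)
    (hB : ∀ x ∈ Metric.closedBall x₀ R, ‖DE t x‖ ≤ B)
    (hL : ∀ l ≤ N, polygonLength pts l ≤ L) (hLR : L ≤ R)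
    {a b : X} (ha : a ∈ Metric.closedBall x₀ R) (hb : b ∈ Metric.closedBall x₀ R)
    (hmod : ∀ s' ∈ Ioc s t, ∀ r ∈ Icc s' t,
      ∀ x ∈ Metric.closedBall x₀ R, ∀ y ∈ Metric.closedBall x₀ R, ‖x - y‖ ≤ ε →
      ‖DE r x - DE s' y‖ ≤ η) :
    deltaNew DE Ψ t a b ≤
      (C + B) * ‖discInterp pts τ N s - a‖ +
        Real.exp (2 * lam * (t - s + τ)) * E t (discInterp pts τ N s) -
        E t (discInterp pts τ N t) + 2 * η * L + (C + B) * ‖b - discInterp pts τ N t‖ := by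
  obtain ⟨hxj, hjN, hjs, hsj⟩ := discInterp_eq pts hτ hN' hs
  obtain ⟨hxi, hiN, hit, -⟩ := discInterp_eq pts hτ hN' ht
  rw [hxj, hxi]
  have hji : ⌊s / τ⌋₊ ≤ ⌊t / τ⌋₊ := Nat.floor_mono (by gcongr)
  set j := ⌊s / τ⌋₊
  set i := ⌊t / τ⌋₊
  have hR : ∀ l ≤ N, pts l ∈ Metric.closedBall x₀ R := fun l hl => by
    rw [mem_closedBall_iff_norm, ← hsol.1]
    exact (norm_sub_zero_le_polygonLength pts l).trans ((hL l hl).trans hLR)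
  have hseg : ∀ p ∈ Metric.closedBall x₀ R, ∀ q ∈ Metric.closedBall x₀ R,
      HasPathCostLE Ψ (fun x => distToSubdiff Ψ (DE t x)) p q ((C + B) * ‖q - p‖) := by
    intro p hp q hq
    refine (hasPathCostLE_segment ((continuous_distToSubdiff hΨnn).comp hDEt) (B := B)
      fun x hx => ?_).mono ?_
    · exact (distToSubdiff_le_norm hΨnn _).trans
        (hB x ((convex_closedBall x₀ R).segment_subset hp hq hx))
    · linarith [hCΨ (q - p)]
  have hmid := hsol.hasPathCostLE hΨnn hΨconv hΨhom hε hDE hDEt hlam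
    (fun x s hs t ht hst => (hgr x s hs t ht hst).1) hτ hN hji hiN hit hR
    (fun s' hs' _ r hr => hmod s' ⟨hsj.trans_le (by simpa using hs'.1), hs'.2⟩ r (by
      rcases hr with rfl | hr
      · exact left_mem_Icc.2 hs'.2
      · rw [mem_singleton_iff.1 hr]
        exact right_mem_Icc.2 hs'.2))
  refine ((((hseg _ ha _ (hR j hjN)).trans hΨhom hmid).trans hΨhom
    (hseg _ (hR i hiN) _ hb)).deltaNew_le hΨnn).trans ?_
  have hjT := mul_mem_Icc_of_le hτ hN hjN
  have hiT := mul_mem_Icc_of_le hτ hN hiN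
  have hej : Real.exp (lam * t) * (Real.exp (-lam * (j * τ)) * E (j * τ) (pts j)) ≤
      Real.exp (2 * lam * (t - s + τ)) * E t (pts j) := by
    rw [← mul_assoc, ← Real.exp_add, show lam * t + -lam * (j * τ) = lam * (t - j * τ) by ring]
    refine (mul_le_mul_of_nonneg_left (hgr (pts j) _ hjT t ht (hjs.trans hst.le)).2
      (Real.exp_pos _).le).trans ?_
    rw [← mul_assoc, ← Real.exp_add]
    refine mul_le_mul_of_nonneg_right (Real.exp_le_exp.2 ?_) (hEnn t ht _)
    have : lam * (t - j * τ) ≤ lam * (t - s + τ) :=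
      mul_le_mul_of_nonneg_left (by linarith) hlam
    linarith
  have hei : E t (pts i) ≤
      Real.exp (lam * t) * (Real.exp (-lam * (i * τ)) * E (i * τ) (pts i)) := by
    rw [← mul_assoc, ← Real.exp_add, show lam * t + -lam * (i * τ) = lam * (t - i * τ) by ring]
    exact (hgr (pts i) _ hiT t ht hit).1
  have hlen : 2 * η * (polygonLength pts i - polygonLength pts j) ≤ 2 * η * L :=
    mul_le_mul_of_nonneg_left (by linarith [hL i hiN, polygonLength_nonneg pts j])
      (by linarith)
  linarith

theorem stmt_16
    {X : Type*} [NormedAddCommGroup X] [NormedSpace ℝ X] [FiniteDimensional ℝ X]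
    [Nontrivial X]
    (hnorm : ContDiffOn ℝ 1 (fun x : X => ‖x‖) {(0 : X)}ᶜ)
    (T : ℝ) (hT : 0 < T)
    (E Et : ℝ → X → ℝ) (DE : ℝ → X → X →L[ℝ] ℝ)
    (hEnn : ∀ t ∈ Set.Icc (0:ℝ) T, ∀ x : X, 0 ≤ E t x)
    (hEt : ∀ x : X, ∀ t ∈ Set.Icc (0:ℝ) T,
      HasDerivWithinAt (fun s => E s x) (Et t x) (Set.Icc 0 T) t)
    (hDE : ∀ t ∈ Set.Icc (0:ℝ) T, ∀ x : X, HasFDerivAt (fun y => E t y) (DE t x) x)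
    (hEtc : ContinuousOn (fun p : ℝ × X => Et p.1 p.2) (Set.Icc 0 T ×ˢ Set.univ))
    (hDEc : ContinuousOn (fun p : ℝ × X => DE p.1 p.2) (Set.Icc 0 T ×ˢ Set.univ))
    (lam : ℝ) (hlam : 0 ≤ lam)
    (hEbound : ∀ s ∈ Set.Icc (0:ℝ) T, ∀ x : X, |Et s x| ≤ lam * E s x)
    (Ψ : X → ℝ) (hΨnn : ∀ v, 0 ≤ Ψ v) (hΨconv : ConvexOn ℝ Set.univ Ψ)
    (hΨhom : ∀ c : ℝ, 0 ≤ c → ∀ v : X, Ψ (c • v) = c * Ψ v)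
    (hΨpos : ∀ v : X, v ≠ 0 → 0 < Ψ v)
    (x₀ : X)
    (εs : ℕ → ℝ) (hεpos : ∀ k, 0 < εs k) (hε0 : Filter.Tendsto εs Filter.atTop (nhds 0))
    (τs : ℕ → ℕ → ℝ) (hτpos : ∀ k n, 0 < τs k n)
    (hτ0 : ∀ k, Filter.Tendsto (τs k) Filter.atTop (nhds 0))
    (Ns : ℕ → ℕ → ℕ)
    (hNT : ∀ k n, (Ns k n : ℝ) * τs k n ≤ T ∧ T < ((Ns k n : ℝ) + 1) * τs k n)
    (pts : ℕ → ℕ → ℕ → X)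
    (hsol : ∀ k n, IsDiscreteSol E Ψ x₀ (εs k) (τs k n) (Ns k n) (pts k n))
    (xe : ℕ → ℝ → X)
    (hconv1 : ∀ k, ∀ t ∈ Set.Icc (0:ℝ) T,
      Filter.Tendsto (fun n => discInterp (pts k n) (τs k n) (Ns k n) t)
        Filter.atTop (nhds (xe k t)))
    (u : ℝ → X)
    (hconv2 : ∀ t ∈ Set.Icc (0:ℝ) T,
      Filter.Tendsto (fun k => xe k t) Filter.atTop (nhds (u t)))
    (t : ℝ) (ht : t ∈ Set.Ioc (0:ℝ) T)
    (um : X) (hum : Filter.Tendsto u (nhdsWithin t (Set.Iio t)) (nhds um))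
    (hjump : um ≠ u t) :
    deltaNew DE Ψ t um (u t) ≤ E t um - E t (u t) := by
  have htI : t ∈ Icc 0 T := ⟨ht.1.le, ht.2⟩
  have hgr : ∀ x, ∀ s ∈ Icc 0 T, ∀ t ∈ Icc 0 T, s ≤ t →
      E t x ≤ Real.exp (lam * (t - s)) * E s x ∧ E s x ≤ Real.exp (lam * (t - s)) * E t x :=
    fun x s hs t ht hst => exp_bounds_of_abs_deriv_le (hEt x) (fun r hr => hEbound r hr x)
      hs ht hst
  obtain ⟨c, C, hc, hcC⟩ := exists_pos_mul_norm_le_of_sublinear hΨconv hΨhom hΨpos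
  set L := Real.exp (lam * T) * E 0 x₀ / c
  have hL0 : 0 ≤ L := div_nonneg (mul_nonneg (Real.exp_pos _).le
    (hEnn 0 (left_mem_Icc.2 hT.le) x₀)) hc.le
  set R := L + ‖um - x₀‖ + ‖u t - x₀‖ with hRdef
  have hDEt : Continuous (DE t) :=
    hDEc.comp_continuous (f := fun x : X => (t, x)) (by fun_prop) fun x => ⟨htI, mem_univ x⟩
  have hEtc' : Continuous (E t) :=
    continuous_iff_continuousAt.2 fun x => (hDE t htI x).continuousAt
  have hball : IsCompact (Metric.closedBall x₀ R) :=
    have := FiniteDimensional.proper ℝ X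
    isCompact_closedBall x₀ R
  obtain ⟨B, hB⟩ := hball.exists_bound_of_continuousOn hDEt.continuousOn
  have huc : UniformContinuousOn (fun p : ℝ × X => DE p.1 p.2)
      (Icc 0 T ×ˢ Metric.closedBall x₀ R) :=
    (isCompact_Icc.prod hball).uniformContinuousOn_of_continuous
      (hDEc.mono (prod_mono_right (subset_univ _)))
  have hηbound : ∀ η > 0, deltaNew DE Ψ t um (u t) ≤ E t um - E t (u t) + 2 * η * L := by
    intro η hη
    obtain ⟨δ, hδ, hmod⟩ := Metric.uniformContinuousOn_iff.1 huc η hη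
    let Φ : ℝ × X × X → ℝ := fun p =>
      (C + B) * ‖p.2.1 - um‖ + Real.exp (2 * lam * p.1) * E t p.2.1 - E t p.2.2 + 2 * η * L +
        (C + B) * ‖u t - p.2.2‖
    have hΦ : Continuous Φ := by fun_prop
    have hdisc : ∀ s ∈ Ioo (t - δ) t, 0 ≤ s → ∀ k, εs k < δ → ∀ n,
        deltaNew DE Ψ t um (u t) ≤ Φ (t - s + τs k n,
          discInterp (pts k n) (τs k n) (Ns k n) s, discInterp (pts k n) (τs k n) (Ns k n) t) := by
      intro s hs hs0 k hk n
      refine (hsol k n).deltaNew_le hEnn hΨnn hΨconv hΨhom (hεpos k) hDE hlam hgr (hτpos k n)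
        (hNT k n).1 (hNT k n).2 ⟨hs0, hs.2.le.trans ht.2⟩ htI hs.2 hDEt hη.le
        (fun v => (hcC v).2) hB (L := L) (R := R) (fun l hl => ?_) ?_ ?_ ?_ ?_
      · exact (hsol k n).polygonLength_le (hεpos k) hΨhom hEnn hlam hc (fun v => (hcC v).1)
          (fun x s hs t ht hst => (hgr x s hs t ht hst).1) (hτpos k n) (hNT k n).1 hl
      · linarith [norm_nonneg (um - x₀), norm_nonneg (u t - x₀)]
      · rw [mem_closedBall_iff_norm]
        linarith [norm_nonneg (u t - x₀)]
      · rw [mem_closedBall_iff_norm]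
        linarith [norm_nonneg (um - x₀)]
      · intro s' hs' r hr x hx y hy hxy
        have h0 : 0 ≤ s' := hs0.trans hs'.1.le
        have h := hmod (r, x) ⟨⟨h0.trans hr.1, hr.2.trans ht.2⟩, hx⟩ (s', y)
          ⟨⟨h0, hs'.2.trans ht.2⟩, hy⟩ (by
            rw [Prod.dist_eq, max_lt_iff, Real.dist_eq, abs_of_nonneg (sub_nonneg.2 hr.1),
              dist_eq_norm]
            exact ⟨by linarith [hr.2, hs'.1, hs.1], hxy.trans_lt hk⟩)
        rw [dist_eq_norm] at h
        exact h.le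
    have hn : ∀ s ∈ Ioo (t - δ) t, 0 ≤ s → ∀ k, εs k < δ →
        deltaNew DE Ψ t um (u t) ≤ Φ (t - s, xe k s, xe k t) := by
      intro s hs hs0 k hk
      have hτlim : Tendsto (fun n => t - s + τs k n) atTop (𝓝 (t - s)) := by
        simpa using (hτ0 k).const_add (t - s)
      exact ge_of_tendsto' ((hΦ.tendsto _).comp (hτlim.prodMk_nhds
        ((hconv1 k s ⟨hs0, hs.2.le.trans ht.2⟩).prodMk_nhds (hconv1 k t htI))))
        (hdisc s hs hs0 k hk)
    have hk : ∀ s ∈ Ioo (t - δ) t, 0 ≤ s →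
        deltaNew DE Ψ t um (u t) ≤ Φ (t - s, u s, u t) := by
      intro s hs hs0
      refine ge_of_tendsto ((hΦ.tendsto _).comp (tendsto_const_nhds.prodMk_nhds
        ((hconv2 s ⟨hs0, hs.2.le.trans ht.2⟩).prodMk_nhds (hconv2 t htI)))) ?_
      filter_upwards [hε0.eventually_lt_const hδ] with k hk using hn s hs hs0 k hk
    have hslim : Tendsto (fun s => t - s) (𝓝[<] t) (𝓝 0) := by
      have : Continuous fun s : ℝ => t - s := by fun_prop
      simpa using (this.tendsto t).mono_left nhdsWithin_le_nhds
    have hlim : deltaNew DE Ψ t um (u t) ≤ Φ (0, um, u t) := by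
      refine ge_of_tendsto ((hΦ.tendsto _).comp (hslim.prodMk_nhds
        (hum.prodMk_nhds tendsto_const_nhds))) ?_
      filter_upwards [Ioo_mem_nhdsLT (sub_lt_self t hδ), Ioo_mem_nhdsLT ht.1] with s hs hs0
        using hk s hs hs0.1.le
    simpa [Φ] using hlim
  have hlim : Tendsto (fun η : ℝ => E t um - E t (u t) + 2 * η * L) (𝓝[>] 0)
      (𝓝 (E t um - E t (u t))) := by
    have : Continuous fun η : ℝ => E t um - E t (u t) + 2 * η * L := by fun_prop
    simpa using (this.tendsto 0).mono_left nhdsWithin_le_nhds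
  exact ge_of_tendsto hlim (eventually_mem_nhdsWithin.mono hηbound)
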